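/- Let X be a connected Hausdorff topological manifold (i.e. every point of X has an open neighbourhood homeomorphic to an open subset of ℝ^m, for a fixed finite m). Suppose there exists a covering map p : E → X from a contractible space E. Then the fundamental group π₁(X, x) is torsion-free: every element of finite order is the identity; equivalently, every finite subgroup of π₁(X, x) is trivial. -/

import Mathlib

section Aa
namespace TFree

set_option linter.unusedSectionVars false
set_option linter.unusedSimpArgs false

/-- Augmented ordered chains on `V`: the empty list sits in degree `-1`. -/
abbrev Ch (p : ℕ) (V : Type*) := List V →₀ ZMod p

noncomputable section

section Basic
variable {p : ℕ} {V W : Type*}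

/-- Prepending a vertex. -/
def co (a : V) : Ch p V →ₗ[ZMod p] Ch p V := Finsupp.lmapDomain _ _ (List.cons a)

/-- Linear extension of a function on lists. -/
def ext (f : List V → Ch p W) : Ch p V →ₗ[ZMod p] Ch p W := Finsupp.linearCombination _ f

/-- Boundary of a single list. -/
def bdl : List V → Ch p V
  | [] => 0
  | a :: l => Finsupp.single l 1 - co a (bdl l)

/-- Boundary. -/
def bd : Ch p V →ₗ[ZMod p] Ch p V := ext bdl

/-- Functoriality. -/
def mp (f : V → W) : Ch p V →ₗ[ZMod p] Ch p W := Finsupp.lmapDomain _ _ (List.map f)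

abbrev δ (l : List V) : Ch p V := Finsupp.single l 1

@[simp] lemma co_δ (a : V) (l : List V) : co a (δ l : Ch p V) = δ (a :: l) := by
  simp [co, Finsupp.mapDomain_single]

@[simp] lemma ext_δ (f : List V → Ch p W) (l : List V) : ext f (δ l) = f l := by
  simp [ext]

@[simp] lemma mp_δ (f : V → W) (l : List V) : mp f (δ l : Ch p V) = δ (l.map f) := by
  simp [mp, Finsupp.mapDomain_single]

@[simp] lemma bd_δ (l : List V) : bd (δ l : Ch p V) = bdl l := by simp [bd]

lemma hom_ext {M : Type*} [AddCommMonoid M] [Module (ZMod p) M] {f g : Ch p V →ₗ[ZMod p] M}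
    (h : ∀ l, f (δ l) = g (δ l)) : f = g := by
  apply Finsupp.lhom_ext'
  intro l
  ext
  exact h l

lemma hom_ext_apply {M : Type*} [AddCommMonoid M] [Module (ZMod p) M]
    {f g : Ch p V →ₗ[ZMod p] M}
    (h : ∀ l, f (δ l) = g (δ l)) (c : Ch p V) : f c = g c := by rw [hom_ext h]

lemma bd_co (a : V) (c : Ch p V) : bd (co a c) = c - co a (bd c) := by
  have := hom_ext_apply (p := p) (f := bd ∘ₗ co a) (g := LinearMap.id - co a ∘ₗ bd)
    (fun l => by simp [bdl]) c
  simpa using this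

lemma bd_bdl (l : List V) : bd (bdl l : Ch p V) = 0 := by
  induction l with
  | nil => simp [bdl]
  | cons a l ih => simp [bdl, bd_co, ih]

lemma bd_bd (c : Ch p V) : bd (bd c) = 0 := by
  have := hom_ext_apply (p := p) (f := bd ∘ₗ bd) (g := (0 : Ch p V →ₗ[ZMod p] Ch p V))
    (fun l => by simp [bd_bdl]) c
  simpa using this

lemma mp_co (f : V → W) (a : V) (c : Ch p V) : mp f (co a c) = co (f a) (mp f c) := by
  have := hom_ext_apply (p := p) (f := mp f ∘ₗ co a) (g := co (f a) ∘ₗ mp f)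
    (fun l => by simp) c
  simpa using this

lemma mp_bdl (f : V → W) (l : List V) : mp f (bdl l : Ch p V) = bdl (l.map f) := by
  induction l with
  | nil => simp [bdl]
  | cons a l ih => simp [bdl, mp_co, ih]

lemma mp_bd (f : V → W) (c : Ch p V) : mp f (bd c) = bd (mp f c) := by
  have := hom_ext_apply (p := p) (f := mp f ∘ₗ bd) (g := bd ∘ₗ mp f)
    (fun l => by simp [mp_bdl]) c
  simpa using this

lemma mp_mp {U : Type*} (f : V → W) (g : W → U) (c : Ch p V) : mp g (mp f c) = mp (g ∘ f) c := by
  have := hom_ext_apply (p := p) (f := mp g ∘ₗ mp f) (g := mp (g ∘ f))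
    (fun l => by simp) c
  simpa using this

lemma mp_id' (f : V → V) (hf : ∀ x, f x = x) (c : Ch p V) : mp f c = c := by
  have : f = id := funext hf
  subst this
  have := hom_ext_apply (p := p) (f := mp (id : V → V)) (g := LinearMap.id) (fun l => by simp) c
  simpa using this

/-- prism on a list -/
def prl (f g : V → W) : List V → Ch p W
  | [] => 0
  | a :: l => δ (f a :: g a :: l.map g) - co (f a) (prl f g l)

/-- prism operator -/
def pr (f g : V → W) : Ch p V →ₗ[ZMod p] Ch p W := ext (prl f g)

@[simp] lemma pr_δ (f g : V → W) (l : List V) : pr f g (δ l : Ch p V) = prl f g l := by simp [pr]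

lemma pr_co (f g : V → W) (a : V) (c : Ch p V) :
    pr f g (co a c) = co (f a) (co (g a) (mp g c)) - co (f a) (pr f g c) := by
  have := hom_ext_apply (p := p) (f := pr f g ∘ₗ co a)
    (g := co (f a) ∘ₗ co (g a) ∘ₗ mp g - co (f a) ∘ₗ pr f g)
    (fun l => by simp [prl]) c
  simpa using this

lemma bd_prl (f g : V → W) (l : List V) :
    bd (prl f g l : Ch p W) + pr f g (bdl l) = δ (l.map g) - δ (l.map f) := by
  induction l with
  | nil => simp [prl, bdl]
  | cons a l ih =>
    have ih' : bd (prl f g l : Ch p W) = δ (l.map g) - δ (l.map f) - pr f g (bdl l) := by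
      rw [← ih]; abel
    simp only [prl, bdl, map_sub, bd_δ, bd_co, ih', pr_co, pr_δ, co_δ, mp_bdl, List.map_cons]
    abel

lemma bd_pr (f g : V → W) (c : Ch p V) :
    bd (pr f g c) = mp g c - mp f c - pr f g (bd c) := by
  have := hom_ext_apply (p := p) (f := bd ∘ₗ pr f g + pr f g ∘ₗ bd) (g := mp g - mp f)
    (fun l => by simp [bd_prl]) c
  simp at this
  rw [← this]; abel

end Basic

section Act
variable {p : ℕ} [Fact p.Prime] {V : Type*} [AddAction (ZMod p) V]

/-- translation -/
def sh (a : ZMod p) : Ch p V →ₗ[ZMod p] Ch p V := mp (fun x => a +ᵥ x)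

/-- norm -/
def nm : Ch p V →ₗ[ZMod p] Ch p V := ∑ a : ZMod p, sh a

/-- alternating operators of the periodic resolution -/
def al (k : ℕ) : Ch p V →ₗ[ZMod p] Ch p V := if Even k then sh 1 - LinearMap.id else nm

lemma sh_sh (a b : ZMod p) (c : Ch p V) : sh a (sh b c) = sh (a + b) c := by
  simp only [sh, mp_mp]
  congr 1
  congr 1
  funext x
  simp [add_vadd]

lemma sh_nm (a : ZMod p) (c : Ch p V) : sh a (nm c) = nm c := by
  simp only [nm, LinearMap.sum_apply, map_sum, sh_sh]
  exact Fintype.sum_equiv (Equiv.addLeft a) _ _ (fun b => rfl)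

lemma nm_sh (a : ZMod p) (c : Ch p V) : nm (sh a c) = nm c := by
  simp only [nm, LinearMap.sum_apply, sh_sh]
  exact Fintype.sum_equiv (Equiv.addRight a) _ _ (fun b => rfl)

lemma al_al (k : ℕ) (c : Ch p V) : al (k + 1) (al k c) = 0 := by
  unfold al
  by_cases h : Even k
  · have h1 : ¬ Even (k + 1) := by simp [Nat.even_add_one, h]
    simp [h, h1, nm_sh]
  · have h1 : Even (k + 1) := by simp [Nat.even_add_one, h]
    simp [h, h1, sh_nm]

lemma al_two (k : ℕ) : (al (k + 2) : Ch p V →ₗ[ZMod p] Ch p V) = al k := by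
  simp [al, Nat.even_add]

lemma bd_sh (a : ZMod p) (c : Ch p V) : bd (sh a c) = sh a (bd c) := by
  simp [sh, mp_bd]

lemma bd_nm (c : Ch p V) : bd (nm c) = nm (bd c) := by
  simp [nm, bd_sh]

lemma bd_al (k : ℕ) (c : Ch p V) : bd (al k c) = al k (bd c) := by
  unfold al
  split_ifs <;> simp [bd_sh, bd_nm]

@[simp] lemma sh_δ (a : ZMod p) (l : List V) : sh a (δ l : Ch p V) = δ (l.map (fun x => a +ᵥ x)) := by
  simp [sh]

lemma al_zero_nil : al 0 (δ [] : Ch p V) = 0 := by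
  simp [al]

end Act

section Final
variable {p : ℕ} [Fact p.Prime]

/-- bad lists: empty, or with an adjacent repetition -/
def Bad (V : Type*) : Set (List V) := {l | l = [] ∨ ¬ l.IsChain (· ≠ ·)}

def Q (p : ℕ) (V : Type*) : Submodule (ZMod p) (Ch p V) := Finsupp.supported _ _ (Bad V)

lemma Q_eq (V : Type*) : Q p V = Submodule.span (ZMod p) ((fun l => δ l) '' Bad V) :=
  Finsupp.supported_eq_span_single _ _

lemma δ_mem_Q {V : Type*} {l : List V} (h : l ∈ Bad V) : (δ l : Ch p V) ∈ Q p V :=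
  Finsupp.single_mem_supported _ _ h

lemma map_Q {V M : Type*} [AddCommMonoid M] [Module (ZMod p) M]
    (S : Submodule (ZMod p) M) (f : Ch p V →ₗ[ZMod p] M)
    (h : ∀ l ∈ Bad V, f (δ l) ∈ S) {c : Ch p V} (hc : c ∈ Q p V) : f c ∈ S := by
  rw [Q_eq] at hc
  have : Submodule.span (ZMod p) ((fun l => (δ l : Ch p V)) '' Bad V) ≤ S.comap f := by
    rw [Submodule.span_le]
    rintro _ ⟨l, hl, rfl⟩
    exact h l hl
  exact this hc

/-- degenerate lists only -/
def Dg (p : ℕ) (V : Type*) : Submodule (ZMod p) (Ch p V) :=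
  Finsupp.supported _ _ {l | ¬ l.IsChain (· ≠ ·)}

lemma Dg_le (V : Type*) : Dg p V ≤ Q p V := Finsupp.supported_mono (fun _ h => Or.inr h)

lemma map_Dg {V M : Type*} [AddCommMonoid M] [Module (ZMod p) M]
    (S : Submodule (ZMod p) M) (f : Ch p V →ₗ[ZMod p] M)
    (h : ∀ l : List V, ¬ l.IsChain (· ≠ ·) → f (δ l) ∈ S) {c : Ch p V} (hc : c ∈ Dg p V) :
    f c ∈ S := by
  unfold Dg at hc
  rw [Finsupp.supported_eq_span_single] at hc
  have : Submodule.span (ZMod p) ((fun l => (δ l : Ch p V)) '' {l | ¬ l.IsChain (· ≠ ·)})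
      ≤ S.comap f := by
    rw [Submodule.span_le]
    rintro _ ⟨l, hl, rfl⟩
    exact h l hl
  exact this hc

lemma co_Dg {V : Type*} (a : V) {c : Ch p V} (hc : c ∈ Dg p V) : co a c ∈ Dg p V := by
  refine map_Dg _ _ (fun l hl => ?_) hc
  rw [co_δ]
  refine Finsupp.single_mem_supported _ _ ?_
  intro h
  exact hl h.tail

lemma co_co_Dg {V : Type*} (a : V) (c : Ch p V) : co a (co a c) ∈ Dg p V := by
  have : ∀ c, (co a ∘ₗ co a) c ∈ Dg p V := by
    intro c
    induction c using Finsupp.induction_linear with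
    | zero => simp
    | add f g hf hg => rw [map_add]; exact add_mem hf hg
    | single l r =>
      have : (Finsupp.single l r : Ch p V) = r • δ l := by simp
      rw [this, map_smul]
      refine Submodule.smul_mem _ _ ?_
      simp only [LinearMap.comp_apply, co_δ]
      refine Finsupp.single_mem_supported _ _ ?_
      intro h
      simp at h
  exact this c

lemma bdl_Dg {V : Type*} (l : List V) (hl : ¬ l.IsChain (· ≠ ·)) : (bdl l : Ch p V) ∈ Dg p V := by
  induction l with
  | nil => simp at hl
  | cons a l ih =>
    by_cases h : l.IsChain (· ≠ ·)
    · cases l with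
      | nil => simp at hl
      | cons b l =>
        have : a = b := by
          by_contra hab
          exact hl (List.IsChain.cons_cons hab h)
        subst this
        simp only [bdl, map_sub, co_δ, sub_sub_cancel]
        exact co_co_Dg _ _
    · exact sub_mem (Finsupp.single_mem_supported _ _ h) (co_Dg _ (ih h))

lemma bd_Q {V : Type*} {c : Ch p V} (hc : c ∈ Q p V) : bd c ∈ Dg p V := by
  refine map_Q _ _ (fun l hl => ?_) hc
  rcases hl with rfl | hl
  · simp [bdl]
  · rw [bd_δ]; exact bdl_Dg l hl

abbrev Z (p : ℕ) := ZMod p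

lemma bad_map {a : ZMod p} {l : List (ZMod p)} (hl : l ∈ Bad (ZMod p)) :
    l.map (fun x => a +ᵥ x) ∈ Bad (ZMod p) := by
  rcases hl with rfl | hl
  · left; simp
  · right
    intro h
    apply hl
    rw [List.isChain_map] at h
    simpa using h

/-- contracting homotopy on lists -/
def sl (l : List (ZMod p)) : Ch p (ZMod p) :=
  ∑ i ∈ Finset.range (l.headD 0).val, δ (l.map (fun x => (-((i : ZMod p) + 1)) +ᵥ x))

def s : Ch p (ZMod p) →ₗ[ZMod p] Ch p (ZMod p) := ext sl

def rl (a : ZMod p) (l : List (ZMod p)) : Ch p (ZMod p) := if l.headD 0 = a then δ l else 0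

def rr (a : ZMod p) : Ch p (ZMod p) →ₗ[ZMod p] Ch p (ZMod p) := ext (rl a)

lemma s_Q {c : Ch p (ZMod p)} (hc : c ∈ Q p (ZMod p)) : s c ∈ Q p (ZMod p) := by
  refine map_Q _ _ (fun l hl => ?_) hc
  simp only [s, ext_δ, sl]
  exact sum_mem fun i _ => δ_mem_Q (bad_map hl)

lemma rr_Q (a : ZMod p) {c : Ch p (ZMod p)} (hc : c ∈ Q p (ZMod p)) : rr a c ∈ Q p (ZMod p) := by
  refine map_Q _ _ (fun l hl => ?_) hc
  simp only [rr, ext_δ, rl]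
  split_ifs
  · exact δ_mem_Q hl
  · simp

lemma mem_Q_of {f : Ch p (ZMod p) →ₗ[ZMod p] Ch p (ZMod p)} (h : ∀ l, f (δ l) ∈ Q p (ZMod p))
    (c : Ch p (ZMod p)) : f c ∈ Q p (ZMod p) := by
  induction c using Finsupp.induction_linear with
  | zero => simp
  | add f g hf hg => rw [map_add]; exact add_mem hf hg
  | single l r =>
    have : (Finsupp.single l r : Ch p (ZMod p)) = r • δ l := by simp
    rw [this, map_smul]
    exact Submodule.smul_mem _ _ (h l)

lemma tele (l : List (ZMod p)) (v : ℕ) :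
    ∑ i ∈ Finset.range v, ((δ (l.map (fun x => (-(i : ZMod p)) +ᵥ x)) : Ch p (ZMod p))
      - δ (l.map (fun x => (-((i : ZMod p) + 1)) +ᵥ x))) = δ l - δ (l.map (fun x => (-(v : ZMod p)) +ᵥ x)) := by
  have := Finset.sum_range_sub' (fun i : ℕ => (δ (l.map (fun x => (-(i : ZMod p)) +ᵥ x)) : Ch p (ZMod p))) v
  simpa using this

lemma hom1 (c : Ch p (ZMod p)) :
    c - ((sh 1 - LinearMap.id : Ch p (ZMod p) →ₗ[ZMod p] Ch p (ZMod p)) (s c) + rr 0 (nm c)) ∈ Q p (ZMod p) := by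
  refine mem_Q_of (f := LinearMap.id - ((sh 1 - LinearMap.id : Ch p (ZMod p) →ₗ[ZMod p] Ch p (ZMod p)) ∘ₗ s + rr 0 ∘ₗ nm)) (fun l => ?_) c
  cases l with
  | nil =>
    simp only [LinearMap.sub_apply, LinearMap.add_apply, LinearMap.comp_apply, s, ext_δ, sl]
    simp only [nm, LinearMap.sum_apply, sh_δ, map_sum, rr, ext_δ, rl]
    simpa using δ_mem_Q (p := p) (V := ZMod p) (l := []) (Or.inl rfl)
  | cons b l =>
    have h1 : (sh 1 - LinearMap.id : Ch p (ZMod p) →ₗ[ZMod p] Ch p (ZMod p)) (s (δ (b :: l))) =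
        (δ (b :: l) : Ch p (ZMod p)) - δ ((b :: l).map (fun x => -b +ᵥ x)) := by
      have := tele (b :: l) b.val
      rw [ZMod.natCast_zmod_val] at this
      rw [← this]
      simp only [s, ext_δ, sl, map_sum, List.headD_cons, LinearMap.sub_apply, sh_δ,
        LinearMap.id_apply, List.map_map]
      refine Finset.sum_congr rfl fun i _ => ?_
      have hf : ((fun x : ZMod p => (1 : ZMod p) +ᵥ x) ∘ fun x => (-((i : ZMod p) + 1)) +ᵥ x)
          = fun x => (-(i : ZMod p)) +ᵥ x := by
        funext x
        simp only [Function.comp, vadd_eq_add]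
        ring
      rw [hf]
    have h2 : rr 0 (nm (δ (b :: l))) = (δ ((b :: l).map (fun x => -b +ᵥ x)) : Ch p (ZMod p)) := by
      simp only [nm, LinearMap.sum_apply, sh_δ, map_sum, rr, ext_δ, rl, List.map_cons,
        List.headD_cons, vadd_eq_add]
      rw [Finset.sum_eq_single (-b)]
      · simp
      · intro a _ ha
        exact if_neg (fun h => ha (eq_neg_of_add_eq_zero_left h))
      · simp
    simp only [LinearMap.sub_apply, LinearMap.add_apply, LinearMap.comp_apply] at h1 ⊢
    rw [h1, h2]
    simp

lemma nm_eq_range (l : List (ZMod p)) (b : ZMod p) :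
    nm (δ l) = ∑ i ∈ Finset.range p, (δ (l.map (fun x => (b - (i : ZMod p)) +ᵥ x)) : Ch p (ZMod p)) := by
  simp only [nm, LinearMap.sum_apply, sh_δ]
  symm
  refine Finset.sum_bij (fun i _ => b - (i : ZMod p)) (by simp) ?_ ?_ (by simp)
  · intro i hi j hj h
    have h' : (i : ZMod p) = j := by simpa using h
    rw [ZMod.natCast_eq_natCast_iff'] at h'
    rwa [Nat.mod_eq_of_lt (by simpa using hi), Nat.mod_eq_of_lt (by simpa using hj)] at h'
  · intro a _
    exact ⟨(b - a).val, by simpa using ZMod.val_lt _, by simp⟩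

lemma hom2 (c : Ch p (ZMod p)) :
    c - (s ((sh 1 - LinearMap.id : Ch p (ZMod p) →ₗ[ZMod p] Ch p (ZMod p)) c) + nm (rr (-1) c)) ∈ Q p (ZMod p) := by
  refine mem_Q_of (f := LinearMap.id - (s ∘ₗ (sh 1 - LinearMap.id : Ch p (ZMod p) →ₗ[ZMod p] Ch p (ZMod p)) + nm ∘ₗ rr (-1))) (fun l => ?_) c
  cases l with
  | nil =>
    have h0 : nm (rr (-1) (δ ([] : List (ZMod p)))) = (0 : Ch p (ZMod p)) := by
      simp only [rr, ext_δ, rl]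
      split_ifs
      · simp [nm]
      · simp
    simp only [LinearMap.sub_apply, LinearMap.add_apply, LinearMap.comp_apply, h0]
    simpa using δ_mem_Q (p := p) (V := ZMod p) (l := []) (Or.inl rfl)
  | cons b l =>
    suffices h : s ((sh 1 - LinearMap.id : Ch p (ZMod p) →ₗ[ZMod p] Ch p (ZMod p)) (δ (b :: l))) + nm (rr (-1) (δ (b :: l)))
        = (δ (b :: l) : Ch p (ZMod p)) by
      simp only [LinearMap.sub_apply, LinearMap.add_apply, LinearMap.comp_apply,
        LinearMap.id_apply] at h ⊢
      rw [h]; simp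
    have key : ∀ v : ℕ, ∑ i ∈ Finset.range (v + 1), (δ (((b :: l).map (fun x => (1 : ZMod p) +ᵥ x)).map
          (fun x => (-((i : ZMod p) + 1)) +ᵥ x)) : Ch p (ZMod p))
        = δ (b :: l) + ∑ i ∈ Finset.range v, δ ((b :: l).map (fun x => (-((i : ZMod p) + 1)) +ᵥ x)) := by
      intro v
      rw [Finset.sum_range_succ', add_comm]
      congr 1
      · simp
      · refine Finset.sum_congr rfl fun i _ => ?_
        rw [List.map_map]
        congr 2
        funext x
        simp only [Function.comp, vadd_eq_add]
        push_cast
        ring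
    simp only [LinearMap.sub_apply, LinearMap.id_apply, map_sub, sh_δ, s, ext_δ, sl, rr, rl]
    by_cases hb : b = -1
    · have hv : b.val + 1 = p := by
        subst hb
        obtain ⟨n, rfl⟩ : ∃ n, p = n + 1 := ⟨p - 1, by have := (Fact.out : p.Prime).pos; omega⟩
        rw [ZMod.val_neg_one]
      have hk := key b.val
      rw [hv] at hk
      have hn := nm_eq_range (b :: l) (0 : ZMod p)
      have hn' : nm (δ (b :: l)) = ∑ i ∈ Finset.range p, (δ (((b :: l).map (fun x => (1 : ZMod p) +ᵥ x)).map
          (fun x => (-((i : ZMod p) + 1)) +ᵥ x)) : Ch p (ZMod p)) := by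
        rw [hn]
        refine Finset.sum_congr rfl fun i _ => ?_
        rw [List.map_map]
        congr 2
        funext x
        simp only [Function.comp, vadd_eq_add]
        ring
      rw [← hn'] at hk
      have h0 : (((b :: l).map (fun x => (1 : ZMod p) +ᵥ x)).headD 0).val = 0 := by
        simp [hb]
      rw [h0]
      simp only [List.headD_cons, hb, if_true, Finset.range_zero, Finset.sum_empty] at hk ⊢
      rw [hk]; simp
    · have h0 : (((b :: l).map (fun x => (1 : ZMod p) +ᵥ x)).headD 0).val = b.val + 1 := by
        simp only [List.map_cons, List.headD_cons, vadd_eq_add, add_comm (1 : ZMod p)]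
        have hp1 : Fact (1 < p) := ⟨(Fact.out : p.Prime).one_lt⟩
        rw [ZMod.val_add_of_lt, ZMod.val_one]
        rw [ZMod.val_one]
        have := ZMod.val_lt b
        by_contra hcon
        apply hb
        have h2 : b.val + 1 = p := by omega
        have h3 : ((b.val + 1 : ℕ) : ZMod p) = 0 := by rw [h2]; simp
        push_cast at h3
        rw [ZMod.natCast_zmod_val] at h3
        exact eq_neg_of_add_eq_zero_left h3
      rw [h0, key]
      simp [hb]

lemma exact_al (k : ℕ) (c : Ch p (ZMod p)) (h : al k c ∈ Q p (ZMod p)) :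
    ∃ w, c - al (k + 1) w ∈ Q p (ZMod p) := by
  unfold al at *
  by_cases hk : Even k
  · have h1 : ¬ Even (k + 1) := by simp [Nat.even_add_one, hk]
    simp only [hk, h1, if_true, if_false] at *
    refine ⟨rr (-1) c, ?_⟩
    have := add_mem (hom2 c) (s_Q h)
    convert this using 1
    abel
  · have h1 : Even (k + 1) := by simp [Nat.even_add_one, hk]
    simp only [hk, h1, if_true, if_false] at *
    refine ⟨s c, ?_⟩
    have := add_mem (hom1 c) (rr_Q 0 h)
    convert this using 1
    abel

lemma bd_Q_nil {c : Ch p (ZMod p)} (h : c ∈ Dg p (ZMod p)) : c [] = 0 := by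
  have := map_Dg (p := p) (V := ZMod p) (⊥ : Submodule (ZMod p) (ZMod p)) (Finsupp.lapply [])
    (fun l hl => ?_) h
  · simpa using this
  · have : l ≠ [] := by rintro rfl; simp at hl
    simp [this]

lemma nm_nil (c : Ch p (ZMod p)) : (nm c) [] = 0 := by
  have := hom_ext_apply (p := p) (V := ZMod p) (f := Finsupp.lapply [] ∘ₗ nm)
    (g := (0 : Ch p (ZMod p) →ₗ[ZMod p] ZMod p)) (fun l => ?_) c
  · simpa using this
  · simp only [LinearMap.comp_apply, nm, LinearMap.sum_apply, sh_δ, map_sum]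
    cases l <;> simp

/-- The algebraic contradiction. -/
theorem alg_false (d : ℕ) (h : ℕ → Ch p (ZMod p)) (h0 : bd (h 0) = δ [])
    (hs : ∀ k < d, bd (h (k + 1)) = al k (h k)) (hd : h d ∈ Q p (ZMod p)) : False := by
  have claim : ∀ j ≤ d, ∃ u v, h (d - j) - bd u - al (d - j + 1) v ∈ Q p (ZMod p) := by
    intro j
    induction j with
    | zero => intro _; exact ⟨0, 0, by simpa using hd⟩
    | succ j ih =>
      intro hj
      obtain ⟨u, v, huv⟩ := ih (by omega)
      have e : d - j = d - (j + 1) + 1 := by omega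
      rw [e, add_assoc, al_two] at huv
      set k := d - (j + 1) with hk
      have h2 := Dg_le _ (bd_Q huv)
      rw [map_sub, map_sub, bd_bd, hs k (by omega), sub_zero, bd_al, ← map_sub] at h2
      obtain ⟨w, hw⟩ := exact_al k _ h2
      exact ⟨v, w, hw⟩
  obtain ⟨u, v, huv⟩ := claim d le_rfl
  have h2 := bd_Q_nil (bd_Q huv)
  rw [Nat.sub_self, map_sub, map_sub, bd_bd, h0, bd_al] at h2
  have h3 : al (0 + 1) (bd v) = nm (bd v) := by simp [al]
  rw [h3] at h2
  simp [nm_nil] at h2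

end Final
end
end TFree
end Aa

section Bb
open Set Filter Topology
namespace TFree
noncomputable section
section Small
variable {p : ℕ} [Fact p.Prime] {V W : Type*}

/-- small chains -/
def SC (p : ℕ) (P : Set V → Prop) : Submodule (ZMod p) (Ch p V) :=
  Finsupp.supported _ _ {l | P {y | y ∈ l}}

lemma map_supp {M : Type*} [AddCommMonoid M] [Module (ZMod p) M] {s : Set (List V)}
    (S : Submodule (ZMod p) M) (f : Ch p V →ₗ[ZMod p] M)
    (h : ∀ l ∈ s, f (δ l) ∈ S) {c : Ch p V} (hc : c ∈ Finsupp.supported (ZMod p) (ZMod p) s) :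
    f c ∈ S := by
  rw [Finsupp.supported_eq_span_single] at hc
  have : Submodule.span (ZMod p) ((fun l => (δ l : Ch p V)) '' s) ≤ S.comap f := by
    rw [Submodule.span_le]
    rintro _ ⟨l, hl, rfl⟩
    exact h l hl
  exact this hc

lemma map_supp_eq {M : Type*} [AddCommGroup M] [Module (ZMod p) M] {s : Set (List V)}
    (f g : Ch p V →ₗ[ZMod p] M)
    (h : ∀ l ∈ s, f (δ l) = g (δ l)) {c : Ch p V}
    (hc : c ∈ Finsupp.supported (ZMod p) (ZMod p) s) :
    f c = g c := by
  have := map_supp (⊥ : Submodule (ZMod p) M) (f - g)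
    (fun l hl => by simp [h l hl]) hc
  simpa [sub_eq_zero] using this

lemma bdl_supp (l : List V) :
    (bdl l : Ch p V) ∈ Finsupp.supported (ZMod p) (ZMod p) {l' : List V | l' ⊆ l} := by
  induction l with
  | nil => simp [bdl]
  | cons a l ih =>
    refine sub_mem (Finsupp.single_mem_supported _ _ (by simp)) ?_
    refine map_supp _ _ (fun l' hl' => ?_) ih
    rw [co_δ]
    exact Finsupp.single_mem_supported _ _ (List.cons_subset_cons a hl')

lemma prl_supp (f g : V → W) (l : List V) :
    (prl f g l : Ch p W) ∈
      Finsupp.supported (ZMod p) (ZMod p) {l' : List W | ∀ z ∈ l', ∃ y ∈ l, z = f y ∨ z = g y} := by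
  induction l with
  | nil => simp [prl]
  | cons a l ih =>
    refine sub_mem (Finsupp.single_mem_supported _ _ ?_) ?_
    · intro z hz
      simp only [List.mem_cons, List.mem_map] at hz ⊢
      rcases hz with rfl | rfl | ⟨y, hy, rfl⟩
      · exact ⟨a, by simp⟩
      · exact ⟨a, by simp⟩
      · exact ⟨y, by simp [hy]⟩
    · refine map_supp _ _ (fun l' hl' => ?_) ih
      rw [co_δ]
      refine Finsupp.single_mem_supported _ _ ?_
      intro z hz
      rcases List.mem_cons.1 hz with rfl | hz
      · exact ⟨a, by simp⟩
      · obtain ⟨y, hy, h⟩ := hl' z hz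
        exact ⟨y, by simp [hy], h⟩

end Small

section Psi
variable {p : ℕ} [Fact p.Prime] {V J : Type*} [LinearOrder J]

open Classical in
/-- phase of the element of minimal index -/
def rS (S : Finset (ZMod p × J)) : ZMod p :=
  if h : S.Nonempty then (S.exists_min_image Prod.snd h).choose.1 else 0

lemma rS_spec {S : Finset (ZMod p × J)} (h : S.Nonempty) :
    ∃ j, (rS S, j) ∈ S ∧ ∀ x ∈ S, j ≤ x.2 := by
  have := (S.exists_min_image Prod.snd h).choose_spec
  refine ⟨(S.exists_min_image Prod.snd h).choose.2, ?_, this.2⟩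
  unfold rS
  rw [dif_pos h]
  exact this.1

open Classical in
/-- label set of a list -/
def Sl (lab : V → ZMod p × J) (l : List V) : Finset (ZMod p × J) := (l.map lab).toFinset

lemma mem_Sl {lab : V → ZMod p × J} {l : List V} {x} : x ∈ Sl lab l ↔ ∃ y ∈ l, lab y = x := by
  simp [Sl]

/-- subdivision map -/
def Psi (lab : V → ZMod p × J) : ℕ → (Ch p V →ₗ[ZMod p] Ch p (ZMod p))
  | 0 => ext (fun _ => δ [])
  | n + 1 => ext (fun l => co (rS (Sl lab l)) (Psi lab n (bdl l)))

lemma Psi_succ (lab : V → ZMod p × J) (n : ℕ) (l : List V) :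
    Psi lab (n + 1) (δ l) = co (rS (Sl lab l)) (Psi lab n (bdl l)) := by
  rw [Psi, ext_δ]

lemma bd_Psi (lab : V → ZMod p × J) (n : ℕ) (c : Ch p V) :
    bd (Psi lab (n + 1) c) = Psi lab n (bd c) := by
  induction n generalizing c with
  | zero =>
    have := hom_ext_apply (p := p) (f := bd ∘ₗ Psi lab 1) (g := Psi lab 0 ∘ₗ bd) (fun l => ?_) c
    · simpa using this
    · have h0 : ∀ c : Ch p V, bd (Psi lab 0 c) = 0 := fun c => by
        have := hom_ext_apply (p := p) (f := bd ∘ₗ Psi lab 0)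
          (g := (0 : Ch p V →ₗ[ZMod p] Ch p (ZMod p))) (fun l => by simp [Psi, bdl]) c
        simpa using this
      simp only [LinearMap.comp_apply, bd_δ]
      rw [show (1 : ℕ) = 0 + 1 from rfl, Psi_succ, bd_co, h0]
      simp
  | succ n ih =>
    have := hom_ext_apply (p := p) (f := bd ∘ₗ Psi lab (n + 2)) (g := Psi lab (n + 1) ∘ₗ bd)
      (fun l => ?_) c
    · simpa using this
    · simp only [LinearMap.comp_apply, bd_δ]
      rw [Psi, ext_δ, bd_co, ih, bd_bdl]
      simp

lemma Psi_nil (lab : V → ZMod p × J) (n : ℕ) : Psi lab (n + 1) (δ []) = 0 := by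
  simp [Psi, bdl]

lemma Psi_Dg (lab : V → ZMod p × J) (n : ℕ) (l : List V) (h : (Sl lab l).card < n) :
    Psi lab n (δ l) ∈ Dg p (ZMod p) := by
  induction n generalizing l with
  | zero => omega
  | succ n ih =>
    rcases List.eq_nil_or_concat l with rfl | hl
    · rw [Psi_nil]; simp
    have hne : (Sl lab l).Nonempty := by
      obtain ⟨a, b, rfl⟩ := hl
      exact ⟨lab b, by simp [mem_Sl]⟩
    have hc := hne.card_pos
    obtain ⟨n, rfl⟩ : ∃ k, n = k + 1 := ⟨n - 1, by omega⟩
    rw [Psi, ext_δ]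
    have := map_supp (p := p) (Dg p (ZMod p)) (co (rS (Sl lab l)) ∘ₗ Psi lab (n + 1))
      (fun l' (hl' : l' ⊆ l) => ?_) (bdl_supp l)
    · exact this
    · have hsub : Sl lab l' ⊆ Sl lab l := by
        intro x hx
        rw [mem_Sl] at *
        obtain ⟨y, hy, h⟩ := hx
        exact ⟨y, hl' hy, h⟩
      rw [LinearMap.comp_apply]
      by_cases he : Sl lab l' = Sl lab l
      · rw [Psi, ext_δ, he]
        exact co_co_Dg _ _
      · refine co_Dg _ (ih l' ?_)
        have := Finset.card_lt_card (Finset.ssubset_iff_subset_ne.2 ⟨hsub, he⟩)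
        omega

variable [AddAction (ZMod p) V]

lemma Psi_sh (lab : V → ZMod p × J) (P : Set V → Prop) (hmono : ∀ A B, A ⊆ B → P B → P A)
    (heq : ∀ l : List V, P {y | y ∈ l} → l ≠ [] → ∀ a : ZMod p,
      rS (Sl lab (l.map (fun x => a +ᵥ x))) = a + rS (Sl lab l)) (n : ℕ) (a : ZMod p)
    (c : Ch p V) (hc : c ∈ SC p P) : Psi lab n (sh a c) = sh a (Psi lab n c) := by
  induction n generalizing c with
  | zero =>
    have := hom_ext_apply (p := p) (f := Psi lab 0 ∘ₗ sh a) (g := sh a ∘ₗ Psi lab 0)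
      (fun l => by simp [Psi]) c
    simpa using this
  | succ n ih =>
    refine map_supp_eq (p := p) (Psi lab (n + 1) ∘ₗ sh a) (sh a ∘ₗ Psi lab (n + 1))
      (fun l hl => ?_) hc
    by_cases hne : l = []
    · subst hne
      simp [Psi_nil]
    · simp only [LinearMap.comp_apply, sh_δ]
      rw [Psi, ext_δ, ext_δ, heq l hl hne a]
      have h1 : (bdl (l.map (fun x => a +ᵥ x)) : Ch p V) = sh a (bdl l) := by
        simp [sh, mp_bdl]
      have h2 : (bdl l : Ch p V) ∈ SC p P := by
        refine Finsupp.supported_mono ?_ (bdl_supp l)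
        intro l' hl'
        exact hmono _ _ (fun y hy => hl' hy) hl
      rw [h1, ih _ h2]
      simp [sh, mp_co]

theorem part_B (d : ℕ) (lab : V → ZMod p × J) (P : Set V → Prop)
    (hmono : ∀ A B, A ⊆ B → P B → P A)
    (hP1 : ∀ A, P A → ∀ y ∈ A, ∀ a : ZMod p, lab (a +ᵥ y) = (a + (lab y).1, (lab y).2))
    (hP2 : ∀ A, P A → ∀ y ∈ A, ∀ z ∈ A, (lab y).2 = (lab z).2 → lab y = lab z)
    (hP3 : ∀ A, P A → (lab '' A).encard ≤ d)
    (h : ℕ → Ch p V) (hsm : ∀ k ≤ d, h k ∈ SC p P) (h0 : bd (h 0) = δ [])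
    (hs : ∀ k < d, bd (h (k + 1)) = al k (h k)) : False := by
  have heq : ∀ l : List V, P {y | y ∈ l} → l ≠ [] → ∀ a : ZMod p,
      rS (Sl lab (l.map (fun x => a +ᵥ x))) = a + rS (Sl lab l) := by
    intro l hl hne a
    obtain ⟨b, l', rfl⟩ := List.exists_cons_of_ne_nil hne
    set l := b :: l' with hldef
    have n1 : (Sl lab l).Nonempty := ⟨lab b, by simp [mem_Sl, hldef]⟩
    have n2 : (Sl lab (l.map (fun x => a +ᵥ x))).Nonempty :=
      ⟨lab (a +ᵥ b), by simp [mem_Sl, hldef]⟩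
    obtain ⟨j1, h1, m1⟩ := rS_spec n1
    obtain ⟨j2, h2, m2⟩ := rS_spec n2
    obtain ⟨y1, hy1, e1⟩ := mem_Sl.1 h1
    obtain ⟨y2', hy2', e2⟩ := mem_Sl.1 h2
    obtain ⟨y2, hy2, rfl⟩ := List.mem_map.1 hy2'
    have f2 := hP1 _ hl y2 hy2 a
    have f1 := hP1 _ hl y1 hy1 a
    have q1 : j1 ≤ (lab y2).2 := m1 _ (mem_Sl.2 ⟨y2, hy2, rfl⟩)
    have q2 : j2 ≤ (lab (a +ᵥ y1)).2 := m2 _ (mem_Sl.2 ⟨_, List.mem_map.2 ⟨y1, hy1, rfl⟩, rfl⟩)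
    rw [f1, e1] at q2
    rw [e2] at f2
    have f21 := congrArg Prod.fst f2
    have f22 := congrArg Prod.snd f2
    simp only at f21 f22 q2
    have hj : (lab y1).2 = (lab y2).2 := by
      rw [e1, ← f22]
      exact le_antisymm (f22 ▸ q1) q2
    have := hP2 _ hl y1 hy1 y2 hy2 hj
    rw [f21, ← this, e1]
  refine alg_false d (fun k => Psi lab (k + 1) (h k)) ?_ ?_ ?_
  · rw [bd_Psi, h0]
    simp [Psi]
  · intro k hk
    rw [bd_Psi, hs k hk]
    have hc := hsm k hk.le
    unfold al
    split_ifs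
    · simp [Psi_sh lab P hmono heq _ _ _ hc]
    · simp [nm, Psi_sh lab P hmono heq _ _ _ hc]
  · refine Dg_le _ ?_
    refine map_supp _ _ (fun l hl => ?_) (hsm d le_rfl)
    apply Psi_Dg
    have := hP3 _ hl
    have e : ((Sl lab l : Finset _) : Set (ZMod p × J)) = lab '' {y | y ∈ l} := by
      ext x
      simp [mem_Sl]
    rw [← e, Set.encard_coe_eq_coe_finsetCard] at this
    have : (Sl lab l).card ≤ d := by exact_mod_cast this
    omega

end Psi

section Fill
variable {p : ℕ} [Fact p.Prime] {V : Type*}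

lemma fill (H : ℝ → V → V) (e : V) (H0 : ∀ x, H 0 x = x) (H1 : ∀ x, H 1 x = e)
    (P P' : Set V → Prop) (hmono : ∀ A B, A ⊆ B → P B → P A) (he : P {e})
    (hP' : ∀ A, P' A → ∀ᶠ n : ℕ in atTop, ∀ j < n,
      P (image2 H (Icc ((j : ℝ) / n) (((j : ℝ) + 1) / n)) A))
    (c : Ch p V) (hc : c ∈ SC p P') (hb : bd c = 0) : ∃ b ∈ SC p P, bd b = c := by
  have hev : ∀ᶠ n : ℕ in atTop, ∀ l ∈ c.support, ∀ j < n,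
      P (image2 H (Icc ((j : ℝ) / n) (((j : ℝ) + 1) / n)) {y | y ∈ l}) := by
    rw [Filter.eventually_all_finset]
    intro l hl
    exact hP' _ (hc hl)
  obtain ⟨n, hn, hn1⟩ := (hev.and (eventually_ge_atTop 1)).exists
  have hn0 : (0 : ℝ) < n := by exact_mod_cast hn1
  refine ⟨co e (mp (H 1) c) -
    ∑ j ∈ Finset.range n, pr (H ((j : ℝ) / n)) (H (((j + 1 : ℕ) : ℝ) / n)) c, ?_, ?_⟩
  · have hcs : c ∈ Finsupp.supported (ZMod p) (ZMod p) (c.support : Set (List V)) :=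
      (Finsupp.mem_supported _ _).2 (Set.Subset.refl _)
    refine sub_mem ?_ (sum_mem fun j hj => ?_)
    · refine map_supp _ (co e ∘ₗ mp (H 1)) (fun l hl => ?_) hcs
      rw [LinearMap.comp_apply, mp_δ, co_δ]
      refine Finsupp.single_mem_supported _ _ (hmono _ _ ?_ he)
      intro z hz
      simp only [mem_ofPred_eq, List.mem_cons, List.mem_map, H1] at hz
      rcases hz with rfl | ⟨_, _, rfl⟩ <;> rfl
    · refine map_supp _ _ (fun l hl => ?_) hcs
      rw [pr_δ]
      refine Finsupp.supported_mono ?_ (prl_supp _ _ l)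
      intro l' hl'
      refine hmono _ _ ?_ (hn l hl j (by simpa using hj))
      intro z hz
      obtain ⟨y, hy, h⟩ := hl' z hz
      have hle : (j : ℝ) / n ≤ ((j : ℝ) + 1) / n := by gcongr; linarith
      rcases h with rfl | rfl
      · exact ⟨_, ⟨le_rfl, hle⟩, y, hy, rfl⟩
      · refine ⟨_, ⟨?_, ?_⟩, y, hy, rfl⟩
        · push_cast; exact hle
        · push_cast; exact le_rfl
  · simp only [map_sub, map_sum, bd_co, bd_pr, hb, ← mp_bd, map_zero, sub_zero]
    rw [Finset.sum_range_sub (fun j : ℕ => mp (H ((j : ℝ) / n)) c)]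
    rw [div_self hn0.ne']
    simp only [Nat.cast_zero, zero_div]
    rw [mp_id' (H 0) H0]
    abel

end Fill

section Level
variable {p : ℕ} [Fact p.Prime] {V : Type*} [TopologicalSpace V] [AddAction (ZMod p) V]

/-- a notion of smallness for subsets of `M` -/
structure Sml (p : ℕ) {V : Type*} [TopologicalSpace V] [AddAction (ZMod p) V]
    (M : Set V) (P : Set V → Prop) : Prop where
  mono : ∀ A B, A ⊆ B → P B → P A
  inv : ∀ A, P A → ∀ a : ZMod p, P ((fun x => a +ᵥ x) '' A)
  loc : ∀ x ∈ M, ∃ O, IsOpen O ∧ x ∈ O ∧ P (O ∩ M)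

lemma tube (H : ℝ → V → V) (hH : Continuous (Function.uncurry H)) {L M : Set V}
    {P : Set V → Prop} (hP : Sml p M P) (hLM : ∀ t ∈ Icc (0 : ℝ) 1, ∀ x ∈ L, H t x ∈ M)
    (x : V) (hx : x ∈ L) : ∃ O, IsOpen O ∧ x ∈ O ∧ ∀ᶠ n : ℕ in atTop, ∀ j < n,
      P (image2 H (Icc ((j : ℝ) / n) (((j : ℝ) + 1) / n)) (O ∩ L)) := by
  have key : ∃ ε > 0, ∃ O, IsOpen O ∧ x ∈ O ∧ ∀ t ∈ Icc (0 : ℝ) 1,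
      P (image2 H (Metric.ball t ε ∩ Icc 0 1) (O ∩ L)) := by
    refine IsCompact.induction_on (p := fun s => ∃ ε > 0, ∃ O, IsOpen O ∧ x ∈ O ∧ ∀ t ∈ s,
      P (image2 H (Metric.ball t ε ∩ Icc 0 1) (O ∩ L))) (isCompact_Icc (a := (0 : ℝ)) (b := 1))
      ?_ ?_ ?_ ?_
    · exact ⟨1, one_pos, univ, isOpen_univ, mem_univ _, by simp⟩
    · rintro s t hst ⟨ε, hε, O, hO, hxO, h⟩
      exact ⟨ε, hε, O, hO, hxO, fun u hu => h u (hst hu)⟩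
    · rintro s t ⟨ε, hε, O, hO, hxO, h⟩ ⟨ε', hε', O', hO', hxO', h'⟩
      refine ⟨min ε ε', lt_min hε hε', O ∩ O', hO.inter hO', ⟨hxO, hxO'⟩, ?_⟩
      rintro u (hu | hu)
      · refine hP.mono _ _ ?_ (h u hu)
        gcongr
        · exact min_le_left _ _
        · exact inter_subset_left
      · refine hP.mono _ _ ?_ (h' u hu)
        gcongr
        · exact min_le_right _ _
        · exact inter_subset_right
    · intro t ht
      obtain ⟨O, hO, hxO, hPO⟩ := hP.loc _ (hLM t ht x hx)
      have hnh : Function.uncurry H ⁻¹' O ∈ 𝓝 (t, x) := (hO.preimage hH).mem_nhds hxO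
      rw [nhds_prod_eq, Filter.mem_prod_iff] at hnh
      obtain ⟨s, hs, N, hN, hsN⟩ := hnh
      obtain ⟨ε, hε, hball⟩ := Metric.mem_nhds_iff.1 hs
      obtain ⟨N', hN', hN'o, hxN'⟩ := mem_nhds_iff.1 hN
      refine ⟨Metric.ball t (ε / 2) ∩ Icc 0 1, ?_, ε / 2, half_pos hε, N', hN'o, hxN', ?_⟩
      · rw [inter_comm]
        exact inter_mem_nhdsWithin _ (Metric.ball_mem_nhds _ (half_pos hε))
      · intro u hu
        refine hP.mono _ _ ?_ hPO
        rintro _ ⟨v, hv, y, hy, rfl⟩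
        refine ⟨?_, hLM v hv.2 y hy.2⟩
        have : (v, y) ∈ s ×ˢ N := by
          refine ⟨hball ?_, hN' hy.1⟩
          have h1 := hv.1
          have h2 := hu.1
          rw [Metric.mem_ball] at *
          linarith [dist_triangle v u t]
        exact hsN this
  obtain ⟨ε, hε, O, hO, hxO, h⟩ := key
  refine ⟨O, hO, hxO, ?_⟩
  have hlim : ∀ᶠ n : ℕ in atTop, 1 / (n : ℝ) < ε :=
    (tendsto_one_div_atTop_nhds_zero_nat).eventually (gt_mem_nhds hε)
  filter_upwards [hlim, eventually_ge_atTop 1] with n hn hn1 j hj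
  have hn0 : (0 : ℝ) < n := by exact_mod_cast hn1
  have hj1 : (j : ℝ) + 1 ≤ n := by exact_mod_cast hj
  have hj0 : (0 : ℝ) ≤ j := by positivity
  have hle : ((j : ℝ) + 1) / n ≤ 1 := by rw [div_le_one hn0]; exact hj1
  have e1 : ((j : ℝ) + 1) / n = j / n + 1 / n := by ring
  have h0 : (0 : ℝ) ≤ j / n := by positivity
  have h1 : 0 < 1 / (n : ℝ) := by positivity
  refine hP.mono _ _ ?_ (h ((j : ℝ) / n) ⟨h0, by linarith⟩)
  refine image2_subset_right ?_
  rintro t ⟨ht0, ht1⟩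
  refine ⟨?_, by linarith, by linarith⟩
  rw [Metric.mem_ball, Real.dist_eq, abs_lt]
  constructor <;> linarith

lemma level (hcont : ∀ a : ZMod p, Continuous (fun x : V => a +ᵥ x))
    (H : ℝ → V → V) (hH : Continuous (Function.uncurry H)) (H0 : ∀ x, H 0 x = x)
    {L M : Set V} (hL : ∀ a : ZMod p, ∀ x ∈ L, a +ᵥ x ∈ L)
    {P : Set V → Prop} (hP : Sml p M P) (hLM : ∀ t ∈ Icc (0 : ℝ) 1, ∀ x ∈ L, H t x ∈ M) :
    ∃ P' : Set V → Prop, Sml p L P' ∧ (∀ A, P' A → P A) ∧ (∀ A, P' A → ∀ᶠ n : ℕ in atTop, ∀ j < n,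
      P (image2 H (Icc ((j : ℝ) / n) (((j : ℝ) + 1) / n)) A)) := by
  have h0im : ∀ A : Set V, (fun x => (0 : ZMod p) +ᵥ x) '' A = A := by
    intro A; simp
  refine ⟨fun A => ∀ a : ZMod p, ∀ᶠ n : ℕ in atTop, ∀ j < n,
      P (image2 H (Icc ((j : ℝ) / n) (((j : ℝ) + 1) / n)) ((fun x => a +ᵥ x) '' A)), ⟨?_, ?_, ?_⟩,
      ?_, ?_⟩
  · intro A B hAB hB a
    filter_upwards [hB a] with n hn j hj
    exact hP.mono _ _ (image2_subset_left (image_mono hAB)) (hn j hj)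
  · intro A hA a b
    have := hA (b + a)
    simpa [image_image, add_vadd] using this
  · intro x hx
    have : ∀ a : ZMod p, ∃ O, IsOpen O ∧ a +ᵥ x ∈ O ∧ ∀ᶠ n : ℕ in atTop, ∀ j < n,
      P (image2 H (Icc ((j : ℝ) / n) (((j : ℝ) + 1) / n)) (O ∩ L)) :=
      fun a => tube H hH hP hLM _ (hL a x hx)
    choose O hO hxO h using this
    refine ⟨⋂ a : ZMod p, (fun x => a +ᵥ x) ⁻¹' O a,
      isOpen_iInter_of_finite fun a => (hO a).preimage (hcont a), mem_iInter.2 hxO, ?_⟩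
    intro a
    filter_upwards [h a] with n hn j hj
    refine hP.mono _ _ (image2_subset_left ?_) (hn j hj)
    rintro _ ⟨y, ⟨hy, hyL⟩, rfl⟩
    exact ⟨mem_iInter.1 hy a, hL a y hyL⟩
  · intro A hA
    obtain ⟨n, hn, hn1⟩ := ((hA 0).and (eventually_ge_atTop 1)).exists
    refine hP.mono _ _ ?_ (hn 0 hn1)
    rw [h0im]
    intro y hy
    refine ⟨0, ⟨by simp, by positivity⟩, y, hy, H0 y⟩
  · intro A hA
    have := hA 0
    rwa [h0im] at this

/-- the growing compact sets -/
def KK (p : ℕ) {V : Type*} [AddAction (ZMod p) V] (H : ℝ → V → V) (e : V) : ℕ → Set V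
  | 0 => range (fun a : ZMod p => a +ᵥ e)
  | n + 1 => ⋃ b : ZMod p, (fun x => b +ᵥ x) '' (image2 H (Icc 0 1) (KK p H e n))

lemma KK_inv (H : ℝ → V → V) (e : V) (n : ℕ) (a : ZMod p) (x : V) (hx : x ∈ KK p H e n) :
    a +ᵥ x ∈ KK p H e n := by
  cases n with
  | zero =>
    obtain ⟨b, rfl⟩ := hx
    exact ⟨a + b, by simp [add_vadd]⟩
  | succ n =>
    simp only [KK, mem_iUnion] at hx ⊢
    obtain ⟨b, y, hy, rfl⟩ := hx
    exact ⟨a + b, y, hy, by simp [add_vadd]⟩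

lemma KK_H (H : ℝ → V → V) (e : V) (n : ℕ) (t : ℝ) (ht : t ∈ Icc (0 : ℝ) 1) (x : V)
    (hx : x ∈ KK p H e n) : H t x ∈ KK p H e (n + 1) := by
  simp only [KK, mem_iUnion]
  exact ⟨0, H t x, ⟨t, ht, x, hx, rfl⟩, by simp⟩

lemma KK_e (H : ℝ → V → V) (e : V) (H1 : ∀ x, H 1 x = e) (n : ℕ) : e ∈ KK p H e n := by
  induction n with
  | zero => exact ⟨0, by simp⟩
  | succ n ih =>
    have := KK_H (p := p) H e n 1 (by simp) e ih
    rwa [H1] at this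

lemma KK_compact (hcont : ∀ a : ZMod p, Continuous (fun x : V => a +ᵥ x))
    (H : ℝ → V → V) (hH : Continuous (Function.uncurry H)) (e : V) (n : ℕ) :
    IsCompact (KK p H e n) := by
  induction n with
  | zero => exact (finite_range _).isCompact
  | succ n ih =>
    refine isCompact_iUnion fun b => IsCompact.image ?_ (hcont b)
    rw [← image_uncurry_prod]
    exact (isCompact_Icc.prod ih).image hH

lemma chains (hcont : ∀ a : ZMod p, Continuous (fun x : V => a +ᵥ x))
    (H : ℝ → V → V) (hH : Continuous (Function.uncurry H)) (e : V) (H0 : ∀ x, H 0 x = x)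
    (H1 : ∀ x, H 1 x = e) (n : ℕ) (P : Set V → Prop) (hP : Sml p (KK p H e n) P) :
    ∃ h : ℕ → Ch p V, (∀ k ≤ n, h k ∈ SC p P) ∧ bd (h 0) = δ [] ∧
      ∀ k < n, bd (h (k + 1)) = al k (h k) := by
  induction n generalizing P with
  | zero =>
    refine ⟨fun _ => δ [e], ?_, ?_, by simp⟩
    · intro k _
      obtain ⟨O, _, hx, hPO⟩ := hP.loc e (KK_e H e H1 0)
      refine Finsupp.single_mem_supported _ _ (hP.mono _ _ ?_ hPO)
      intro y hy
      have : y = e := by simpa using hy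
      subst this
      exact ⟨hx, KK_e H _ H1 0⟩
    · simp [bdl]
  | succ n ih =>
    obtain ⟨P', hP', hPP', hev⟩ := level hcont H hH H0 (KK_inv H e n) hP (KK_H H e n)
    obtain ⟨h, hsm, h0, hs⟩ := ih P' hP'
    have hsc : al n (h n) ∈ SC p P' := by
      have hsh : ∀ a : ZMod p, sh a (h n) ∈ SC p P' := by
        intro a
        refine map_supp _ _ (fun l hl => ?_) (hsm n le_rfl)
        rw [sh_δ]
        refine Finsupp.single_mem_supported _ _ ?_
        have := hP'.inv _ hl a
        refine hP'.mono _ _ ?_ this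
        intro y hy
        simpa using hy
      unfold al
      split_ifs
      · exact sub_mem (hsh 1) (hsm n le_rfl)
      · rw [nm, LinearMap.sum_apply]
        exact sum_mem fun a _ => hsh a
    have hbd : bd (al n (h n)) = 0 := by
      rw [bd_al]
      cases n with
      | zero => rw [h0, al_zero_nil]
      | succ n => rw [hs n (by omega), al_al]
    have he : P {e} := by
      obtain ⟨O, _, hx, hPO⟩ := hP.loc e (KK_e H e H1 _)
      refine hP.mono _ _ ?_ hPO
      rintro _ rfl
      exact ⟨hx, KK_e H _ H1 _⟩
    obtain ⟨b, hb, hbb⟩ := fill H e H0 H1 P P' hP.mono he hev _ hsc hbd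
    refine ⟨Function.update h (n + 1) b, ?_, ?_, ?_⟩
    · intro k hk
      rcases Nat.lt_or_ge n k with hk' | hk'
      · obtain rfl : k = n + 1 := by omega
        simpa using hb
      · rw [Function.update_of_ne (by omega)]
        refine Finsupp.supported_mono ?_ (hsm k hk')
        intro l hl
        exact hPP' _ hl
    · rw [Function.update_of_ne (by omega)]; exact h0
    · intro k hk
      rcases Nat.lt_or_ge k n with hk' | hk'
      · rw [Function.update_of_ne (by omega), Function.update_of_ne (by omega)]
        exact hs k hk'
      · obtain rfl : k = n := by omega
        rw [Function.update_self, Function.update_of_ne (by omega)]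
        exact hbb

end Level

section Dim

lemma grid {m : ℕ} {ι : Type*} (K : Set (Fin m → ℝ)) (hK : IsCompact K)
    (O : ι → Set (Fin m → ℝ)) (hO : ∀ j, IsOpen (O j)) (hcov : K ⊆ ⋃ j, O j) :
    ∃ V : ι → Set (Fin m → ℝ), (∀ j, IsOpen (V j)) ∧ K ⊆ ⋃ j, V j ∧
      (∀ j, V j ∩ K ⊆ O j) ∧ ∀ y, {j | y ∈ V j}.encard ≤ 2 ^ m := by
  classical
  rcases isEmpty_or_nonempty ι with hι | hι
  · exact ⟨fun _ => ∅, fun _ => isOpen_empty, by simpa using hcov, fun j => hι.elim j, fun y => by simp⟩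
  obtain ⟨ε, hε, hleb⟩ := lebesgue_number_lemma_of_metric hK hO hcov
  let C : (Fin m → ℤ) → Set (Fin m → ℝ) := fun k => {y | ∀ i, |y i / (ε / 2) - k i| < 1}
  have hCo : ∀ k, IsOpen (C k) := by
    intro k
    have : C k = ⋂ i, {y | |y i / (ε / 2) - k i| < 1} := by ext; simp [C]
    rw [this]
    exact isOpen_iInter_of_finite fun i => isOpen_lt (by fun_prop) (by fun_prop)
  have hdist : ∀ k, ∀ y ∈ C k, ∀ z ∈ C k, dist y z < ε := by
    intro k y hy z hz
    rw [dist_pi_lt_iff hε]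
    intro i
    have h1 := abs_lt.1 (hy i)
    have h2 := abs_lt.1 (hz i)
    have h3 : |y i / (ε / 2) - z i / (ε / 2)| < 2 := abs_lt.2 ⟨by linarith [h1.1, h2.2], by linarith [h1.2, h2.1]⟩
    rw [← sub_div, abs_div, abs_of_pos (half_pos hε), div_lt_iff₀ (half_pos hε)] at h3
    rw [Real.dist_eq]
    linarith
  have hex : ∀ k, ∃ i, (C k ∩ K).Nonempty → C k ⊆ O i := by
    intro k
    by_cases h : (C k ∩ K).Nonempty
    · obtain ⟨x, hx, hxK⟩ := h
      obtain ⟨i, hi⟩ := hleb x hxK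
      exact ⟨i, fun _ y hy => hi (Metric.mem_ball.2 (hdist k y hy x hx))⟩
    · exact ⟨hι.some, fun h' => absurd h' h⟩
  choose f hf using hex
  refine ⟨fun j => ⋃ k, ⋃ (_ : f k = j ∧ (C k ∩ K).Nonempty), C k, ?_, ?_, ?_, ?_⟩
  · intro j
    exact isOpen_iUnion fun k => isOpen_iUnion fun _ => hCo k
  · intro y hy
    have hyC : y ∈ C (fun i => ⌊y i / (ε / 2)⌋) := by
      intro i
      have h1 := Int.floor_le (y i / (ε / 2))
      have h2 := Int.lt_floor_add_one (y i / (ε / 2))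
      exact abs_lt.2 ⟨by linarith, by linarith⟩
    simp only [mem_iUnion]
    exact ⟨_, _, ⟨rfl, ⟨y, hyC, hy⟩⟩, hyC⟩
  · rintro j y ⟨hy, hyK⟩
    simp only [mem_iUnion] at hy
    obtain ⟨k, ⟨rfl, hk⟩, hy⟩ := hy
    exact hf k hk hy
  · intro y
    have hsub : {j | y ∈ ⋃ k, ⋃ (_ : f k = j ∧ (C k ∩ K).Nonempty), C k} ⊆
        f '' ((Fintype.piFinset fun i => ({⌊y i / (ε / 2)⌋, ⌊y i / (ε / 2)⌋ + 1} : Finset ℤ) :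
          Finset (Fin m → ℤ)) : Set (Fin m → ℤ)) := by
      intro j hj
      simp only [mem_ofPred_eq, mem_iUnion] at hj
      obtain ⟨k, ⟨hk, -⟩, hy⟩ := hj
      refine ⟨k, ?_, hk⟩
      rw [Finset.mem_coe, Fintype.mem_piFinset]
      intro i
      have h := abs_lt.1 (hy i)
      have h1 := Int.floor_le (y i / (ε / 2))
      have h2 := Int.lt_floor_add_one (y i / (ε / 2))
      have h3 : (⌊y i / (ε / 2)⌋ : ℝ) < k i + 1 := by linarith [h.2]
      have h4 : (k i : ℝ) < ⌊y i / (ε / 2)⌋ + 2 := by linarith [h.1]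
      have h3' : ⌊y i / (ε / 2)⌋ < k i + 1 := by exact_mod_cast h3
      have h4' : k i < ⌊y i / (ε / 2)⌋ + 2 := by exact_mod_cast h4
      simp only [Finset.mem_insert, Finset.mem_singleton]
      omega
    refine (encard_le_encard hsub).trans ((encard_image_le _ _).trans ?_)
    rw [encard_coe_eq_coe_finsetCard, Fintype.card_piFinset]
    have : (∏ i : Fin m, ({⌊y i / (ε / 2)⌋, ⌊y i / (ε / 2)⌋ + 1} : Finset ℤ).card) ≤ 2 ^ m := by
      refine (Finset.prod_le_prod' (fun i _ => Finset.card_le_two)).trans ?_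
      simp
    exact_mod_cast this

variable {p : ℕ} [Fact p.Prime] {V : Type*} [TopologicalSpace V] [AddAction (ZMod p) V]

/-- invariant sets -/
def Inva (p : ℕ) {V : Type*} [AddAction (ZMod p) V] (S : Set V) : Prop :=
  ∀ (a : ZMod p) (x : V), x ∈ S → a +ᵥ x ∈ S

lemma Inva.iff {S : Set V} (h : Inva p S) (a : ZMod p) (x : V) : a +ᵥ x ∈ S ↔ x ∈ S :=
  ⟨fun hx => by simpa using h (-a) _ hx, h a x⟩

/-- saturation of a set -/
def sat (p : ℕ) {V : Type*} [AddAction (ZMod p) V] (S : Set V) : Set V :=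
  {y | ∃ a : ZMod p, a +ᵥ y ∈ S}

lemma sat_inva (S : Set V) : Inva p (sat p S) := by
  rintro a x ⟨b, hb⟩
  refine ⟨b - a, ?_⟩
  rwa [vadd_vadd, sub_add_cancel]

lemma subset_sat (S : Set V) : S ⊆ sat p S := fun x hx => ⟨0, by simpa using hx⟩

lemma sat_subset {S T : Set V} (h : S ⊆ T) (hT : Inva p T) : sat p S ⊆ T := by
  rintro x ⟨a, ha⟩
  exact (hT.iff a x).1 (h ha)

lemma sat_mono {S T : Set V} (h : S ⊆ T) : sat p S ⊆ sat p T :=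
  fun _ ⟨a, ha⟩ => ⟨a, h ha⟩

lemma sat_compact (hcont : ∀ a : ZMod p, Continuous (fun x : V => a +ᵥ x)) {S : Set V}
    (hS : IsCompact S) : IsCompact (sat p S) := by
  have : sat p S = ⋃ a : ZMod p, (fun x => a +ᵥ x) '' S := by
    ext x
    simp only [sat, mem_ofPred_eq, mem_iUnion, mem_image]
    constructor
    · rintro ⟨a, ha⟩
      exact ⟨-a, _, ha, by simp⟩
    · rintro ⟨a, y, hy, rfl⟩
      exact ⟨-a, by simpa using hy⟩
  rw [this]
  exact isCompact_iUnion fun a => hS.image (hcont a)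

lemma shrink_one [T2Space V] {m : ℕ} {ι : Type*} (M : Set V) (U : ι → Set V)
    (hU : ∀ j, IsOpen (U j)) (hUi : ∀ j, Inva p (U j)) (hUc : M ⊆ ⋃ j, U j)
    (A : Set V) (hA : IsCompact A) (hAi : Inva p A) (hAM : A ⊆ M)
    (χ : V → (Fin m → ℝ)) (hχ : ContinuousOn χ A)
    (hχi : ∀ (a : ZMod p), ∀ x ∈ A, χ (a +ᵥ x) = χ x)
    (hχf : ∀ x ∈ A, ∀ y ∈ A, χ x = χ y → ∃ a : ZMod p, y = a +ᵥ x) :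
    ∃ U' : ι → Set V, (∀ j, U' j ⊆ U j) ∧ (∀ j, IsOpen (U' j)) ∧ (∀ j, Inva p (U' j)) ∧
      M ⊆ ⋃ j, U' j ∧ ∀ x ∈ A, {j | x ∈ U' j}.encard ≤ 2 ^ m := by
  obtain ⟨W, hWo, hWc, hWO, hWn⟩ := grid (χ '' A) (hA.image_of_continuousOn hχ)
    (fun j => (χ '' (A \ U j))ᶜ)
    (fun j => ((hA.diff (hU j)).image_of_continuousOn (hχ.mono sdiff_subset)).isClosed.isOpen_compl)
    (by
      rintro _ ⟨x, hx, rfl⟩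
      obtain ⟨j, hj⟩ := mem_iUnion.1 (hUc (hAM hx))
      refine mem_iUnion.2 ⟨j, ?_⟩
      rintro ⟨y, ⟨hyA, hyU⟩, hxy⟩
      obtain ⟨a, rfl⟩ := hχf x hx y hyA hxy.symm
      exact hyU (hUi j a x hj))
  have hmem : ∀ j, ∀ x ∈ A, χ x ∈ W j → x ∈ U j := by
    intro j x hx hxW
    by_contra hxU
    exact hWO j ⟨hxW, mem_image_of_mem _ hx⟩ ⟨x, ⟨hx, hxU⟩, rfl⟩
  refine ⟨fun j => U j \ (A ∩ χ ⁻¹' (W j)ᶜ), fun j => sdiff_subset, ?_, ?_, ?_, ?_⟩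
  · intro j
    exact (hU j).sdiff (hχ.preimage_isClosed_of_isClosed hA.isClosed (hWo j).isClosed_compl)
  · rintro j a x ⟨hx, hx'⟩
    refine ⟨hUi j a x hx, ?_⟩
    rintro ⟨h1, h2⟩
    have h1' := (hAi.iff a x).1 h1
    refine hx' ⟨h1', ?_⟩
    rw [mem_preimage, hχi a x h1'] at h2
    exact h2
  · intro x hx
    by_cases hxA : x ∈ A
    · obtain ⟨j, hj⟩ := mem_iUnion.1 (hWc (mem_image_of_mem _ hxA))
      exact mem_iUnion.2 ⟨j, hmem j x hxA hj, fun h => h.2 hj⟩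
    · obtain ⟨j, hj⟩ := mem_iUnion.1 (hUc hx)
      exact mem_iUnion.2 ⟨j, hj, fun h => hxA h.1⟩
  · intro x hx
    refine (encard_le_encard ?_).trans (hWn (χ x))
    rintro j ⟨h1, h2⟩
    by_contra h
    exact h2 ⟨hx, h⟩

lemma shrink_all [T2Space V] {m : ℕ} {ι κ : Type*} (M : Set V) (U : ι → Set V)
    (hU : ∀ j, IsOpen (U j)) (hUi : ∀ j, Inva p (U j)) (hUc : M ⊆ ⋃ j, U j)
    (A : κ → Set V) (hA : ∀ k, IsCompact (A k)) (hAi : ∀ k, Inva p (A k)) (hAM : ∀ k, A k ⊆ M)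
    (χ : κ → V → (Fin m → ℝ)) (hχ : ∀ k, ContinuousOn (χ k) (A k))
    (hχi : ∀ k, ∀ (a : ZMod p), ∀ x ∈ A k, χ k (a +ᵥ x) = χ k x)
    (hχf : ∀ k, ∀ x ∈ A k, ∀ y ∈ A k, χ k x = χ k y → ∃ a : ZMod p, y = a +ᵥ x)
    (s : Finset κ) :
    ∃ U' : ι → Set V, (∀ j, U' j ⊆ U j) ∧ (∀ j, IsOpen (U' j)) ∧ (∀ j, Inva p (U' j)) ∧
      M ⊆ ⋃ j, U' j ∧ ∀ k ∈ s, ∀ x ∈ A k, {j | x ∈ U' j}.encard ≤ 2 ^ m := by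
  classical
  induction s using Finset.induction_on with
  | empty => exact ⟨U, fun _ => subset_rfl, hU, hUi, hUc, by simp⟩
  | insert k s _ ih =>
    obtain ⟨U₁, h1, h2, h3, h4, h5⟩ := ih
    obtain ⟨U₂, g1, g2, g3, g4, g5⟩ := shrink_one M U₁ h2 h3 h4 (A k) (hA k) (hAi k) (hAM k)
      (χ k) (hχ k) (hχi k) (hχf k)
    refine ⟨U₂, fun j => (g1 j).trans (h1 j), g2, g3, g4, ?_⟩
    intro l hl x hx
    rcases Finset.mem_insert.1 hl with rfl | hl
    · exact g5 x hx
    · exact (encard_le_encard fun j hj => g1 j hj).trans (h5 l hl x hx)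

/-- the local hypothesis -/
def Loc (p : ℕ) {V : Type*} [TopologicalSpace V] [AddAction (ZMod p) V] (m : ℕ) (W : Set V) :
    Prop :=
  IsOpen W ∧ (∀ a : ZMod p, a ≠ 0 → ∀ y ∈ W, a +ᵥ y ∉ W) ∧ ∃ χ : V → (Fin m → ℝ),
    ContinuousOn χ (sat p W) ∧ (∀ a : ZMod p, ∀ y ∈ sat p W, χ (a +ᵥ y) = χ y) ∧ InjOn χ W

lemma sat_open (hcont : ∀ a : ZMod p, Continuous (fun x : V => a +ᵥ x)) {S : Set V}
    (hS : IsOpen S) : IsOpen (sat p S) := by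
  have : sat p S = ⋃ a : ZMod p, (fun x => a +ᵥ x) ⁻¹' S := by
    ext x
    simp [sat]
  rw [this]
  exact isOpen_iUnion fun a => hS.preimage (hcont a)

lemma cover [T2Space V] (hcont : ∀ a : ZMod p, Continuous (fun x : V => a +ᵥ x)) (m : ℕ)
    (hloc : ∀ x : V, ∃ W, x ∈ W ∧ Loc p m W) (M : Set V) (hM : IsCompact M) (hMi : Inva p M) :
    ∃ (n : ℕ) (W C : Fin n → Set V), (∀ j, Loc p m (W j)) ∧ (∀ j, IsClosed (C j)) ∧
      (∀ j, Inva p (C j)) ∧ (∀ j, C j ⊆ sat p (W j)) ∧ M ⊆ ⋃ j, C j ∧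
      ∀ x, {j | x ∈ C j}.encard ≤ 2 ^ m := by
  classical
  choose W hxW hW using hloc
  have hsep : ∀ x : V, ∃ B A : Set V, IsOpen B ∧ x ∈ B ∧ IsCompact A ∧ A ⊆ M ∧ A ⊆ W x ∧
      B ∩ M ⊆ A := by
    intro x
    obtain ⟨B, D, hB, hD, hxB, hMD, hBD⟩ := SeparatedNhds.of_isCompact_isCompact
      (isCompact_singleton (x := x)) (hM.diff (hW x).1) (by
        rw [disjoint_singleton_left]
        exact fun h => h.2 (hxW x))
    refine ⟨B, M \ D, hB, hxB rfl, hM.diff hD, sdiff_subset, ?_, ?_⟩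
    · rintro y ⟨hy, hyD⟩
      by_contra h
      exact hyD (hMD ⟨hy, h⟩)
    · rintro y ⟨hy, hyM⟩
      exact ⟨hyM, fun h => disjoint_left.1 hBD hy h⟩
  choose B A hB hxB hA hAM hAW hBA using hsep
  obtain ⟨t, ht⟩ := hM.elim_finite_subcover B hB (fun x _ => mem_iUnion.2 ⟨x, hxB x⟩)
  let f : Fin t.card → V := fun i => (t.equivFin.symm i : V)
  have hf : M ⊆ ⋃ i, A (f i) := by
    intro x hx
    obtain ⟨y, hy, hxy⟩ := mem_iUnion₂.1 (ht hx)
    refine mem_iUnion.2 ⟨t.equivFin ⟨y, hy⟩, ?_⟩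
    simp only [f, Equiv.symm_apply_apply]
    exact hBA y ⟨hxy, hx⟩
  choose hWo hWfree χ hχ hχi hχinj using hW
  have hsA : ∀ x, sat p (A x) ⊆ sat p (W x) := fun x => sat_mono (hAW x)
  obtain ⟨U, hU1, hU2, hU3, hU4, hU5⟩ := shrink_all (p := p) (m := m) M (fun i => sat p (W (f i)))
    (fun i => sat_open hcont (hWo _)) (fun i => sat_inva _)
    (hf.trans (iUnion_mono fun i => (hAW _).trans (subset_sat _)))
    (fun i => sat p (A (f i))) (fun i => sat_compact hcont (hA _)) (fun i => sat_inva _)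
    (fun i => sat_subset (hAM _) hMi) (fun i => χ (f i)) (fun i => (hχ _).mono (hsA _))
    (fun i a x hx => hχi _ a x (hsA _ hx))
    (by
      intro i x hx y hy hxy
      obtain ⟨a, ha⟩ := hsA _ hx
      obtain ⟨b, hb⟩ := hsA _ hy
      have := hχinj (f i) ha hb (by rw [hχi _ _ _ (hsA _ hx), hχi _ _ _ (hsA _ hy), hxy])
      refine ⟨-b + a, ?_⟩
      rw [← vadd_vadd, this, neg_vadd_vadd]) Finset.univ
  have hord : ∀ x ∈ M, {j | x ∈ U j}.encard ≤ 2 ^ m := by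
    intro x hx
    obtain ⟨i, hi⟩ := mem_iUnion.1 (hf hx)
    exact hU5 i (Finset.mem_univ _) x (subset_sat _ hi)
  have : CompactSpace M := isCompact_iff_compactSpace.1 hM
  obtain ⟨C, hC1, hC2, hC3⟩ := exists_iUnion_eq_closed_subset (X := M)
    (u := fun i => Subtype.val ⁻¹' U i) (fun i => (hU2 i).preimage continuous_subtype_val)
    (fun x => toFinite _) (by
      rw [← preimage_iUnion]
      exact eq_univ_of_forall fun x => hU4 x.2)
  have hCU : ∀ j, sat p (Subtype.val '' C j) ⊆ U j := fun j => sat_subset (by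
    rintro _ ⟨x, hx, rfl⟩
    exact hC3 j hx) (hU3 j)
  have hCM : ∀ j, sat p (Subtype.val '' C j) ⊆ M := fun j => sat_subset (by
    rintro _ ⟨x, hx, rfl⟩
    exact x.2) hMi
  refine ⟨t.card, fun i => W (f i), fun j => sat p (Subtype.val '' C j), fun j => ⟨hWo _, hWfree _, χ _, hχ _, hχi _, hχinj _⟩, ?_, fun j => sat_inva _, fun j => (hCU j).trans (hU1 j), ?_, ?_⟩
  · intro j
    exact (sat_compact hcont ((hC2 j).isCompact.image continuous_subtype_val)).isClosed
  · intro x hx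
    have : (⟨x, hx⟩ : M) ∈ ⋃ i, C i := by rw [hC1]; trivial
    obtain ⟨j, hj⟩ := mem_iUnion.1 this
    exact mem_iUnion.2 ⟨j, subset_sat _ ⟨_, hj, rfl⟩⟩
  · intro x
    by_cases hx : x ∈ M
    · exact (encard_le_encard fun j hj => hCU j hj).trans (hord x hx)
    · have : {j | x ∈ sat p (Subtype.val '' C j)} = ∅ := by
        ext j
        simp only [mem_ofPred_eq, mem_empty_iff_false, iff_false]
        exact fun h => hx (hCM j h)
      rw [this]; simp

theorem core0 [T2Space V] (hcont : ∀ a : ZMod p, Continuous (fun x : V => a +ᵥ x)) (m : ℕ)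
    (hloc : ∀ x : V, ∃ W, x ∈ W ∧ Loc p m W)
    (H : ℝ → V → V) (hH : Continuous (Function.uncurry H)) (e : V)
    (H0 : ∀ x, H 0 x = x) (H1 : ∀ x, H 1 x = e) : False := by
  classical
  let M := KK p H e (2 ^ m)
  have hMi : Inva p M := fun a x hx => KK_inv H e _ a x hx
  obtain ⟨n, W, C, hW, hCc, hCi, hCW, hMC, hord⟩ :=
    cover hcont m hloc M (KK_compact hcont H hH e _) hMi
  choose hWo hWfree _ _ using hW
  have hphi : ∃ φ : Fin n → V → ZMod p, ∀ j, ∀ y ∈ C j, (-(φ j y)) +ᵥ y ∈ W j := by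
    have : ∀ j y, ∃ a : ZMod p, y ∈ C j → (-a) +ᵥ y ∈ W j := by
      intro j y
      by_cases hy : y ∈ C j
      · obtain ⟨a, ha⟩ := hCW j hy
        exact ⟨-a, fun _ => by simpa using ha⟩
      · exact ⟨0, fun h => absurd h hy⟩
    choose φ hφ using this
    exact ⟨φ, hφ⟩
  obtain ⟨φ, hφ⟩ := hphi
  have huniq : ∀ j, ∀ y ∈ C j, ∀ a : ZMod p, (-a) +ᵥ y ∈ W j → φ j y = a := by
    intro j y hy a ha
    by_contra hne
    refine hWfree j (a - φ j y) (sub_ne_zero.2 (Ne.symm hne)) _ ha ?_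
    rw [vadd_vadd]
    convert hφ j y hy using 2
    ring
  have hj : ∀ y : V, ∃ j : Fin n, y ∈ M → y ∈ C j ∧ ∀ i, y ∈ C i → j ≤ i := by
    intro y
    by_cases hy : y ∈ M
    · have hne : {j | y ∈ C j}.Nonempty := mem_iUnion.1 (hMC hy)
      obtain ⟨j, hj, hj'⟩ := (toFinite {j | y ∈ C j}).exists_minimal hne
      exact ⟨j, fun _ => ⟨hj, fun i hi => by
        rcases le_total j i with h | h
        · exact h
        · exact hj' hi h⟩⟩
    · obtain ⟨j, _⟩ := mem_iUnion.1 (hMC (KK_e H e H1 (2 ^ m)))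
      exact ⟨j, fun h => absurd h hy⟩
  choose jl hjl using hj
  have hjinv : ∀ y ∈ M, ∀ a : ZMod p, jl (a +ᵥ y) = jl y := by
    intro y hy a
    have h1 := hjl y hy
    have h2 := hjl _ (hMi a y hy)
    exact le_antisymm (h2.2 _ (hCi _ a y h1.1)) (h1.2 _ (((hCi _).iff a y).1 h2.1))
  let lab : V → ZMod p × Fin n := fun y => (φ (jl y) y, jl y)
  have hlab : ∀ y ∈ M, ∀ a : ZMod p, lab (a +ᵥ y) = (a + (lab y).1, (lab y).2) := by
    intro y hy a
    simp only [lab, hjinv y hy a, Prod.mk.injEq, and_true]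
    have h1 := (hjl y hy).1
    apply huniq _ _ (hCi _ a y h1)
    rw [vadd_vadd]
    convert hφ _ y h1 using 2
    ring
  let P : Set V → Prop := fun A => A ⊆ M ∧ (∀ y ∈ A, ∀ z ∈ A, (lab y).2 = (lab z).2 → lab y = lab z) ∧
    (lab '' A).encard ≤ ((2 ^ m : ℕ) : ℕ∞)
  have hS : Sml p M P := by
    refine ⟨?_, ?_, ?_⟩
    · rintro A B hAB ⟨h1, h2, h3⟩
      exact ⟨hAB.trans h1, fun y hy z hz => h2 y (hAB hy) z (hAB hz),
        (encard_le_encard (image_mono hAB)).trans h3⟩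
    · rintro A ⟨h1, h2, h3⟩ a
      refine ⟨?_, ?_, ?_⟩
      · rintro _ ⟨y, hy, rfl⟩
        exact hMi a y (h1 hy)
      · rintro _ ⟨y, hy, rfl⟩ _ ⟨z, hz, rfl⟩
        simp only [hlab y (h1 hy), hlab z (h1 hz)]
        intro h
        rw [h2 y hy z hz h]
      · have : lab '' ((fun x => a +ᵥ x) '' A) =
            (fun q : ZMod p × Fin n => (a + q.1, q.2)) '' (lab '' A) := by
          rw [image_image, image_image]
          exact image_congr fun y hy => hlab y (h1 hy) a
        rw [this]
        exact (encard_image_le _ _).trans h3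
    · intro x hx
      let O : Set V := ⋂ j : Fin n, if x ∈ C j then (fun y => (-(φ j x)) +ᵥ y) ⁻¹' W j else (C j)ᶜ
      have hOx : ∀ y ∈ O ∩ M, jl y ∈ {j | x ∈ C j} ∧ lab y = (φ (jl y) x, jl y) := by
        rintro y ⟨hyO, hyM⟩
        have h1 := (hjl y hyM).1
        have h2 := mem_iInter.1 hyO (jl y)
        by_cases hxC : x ∈ C (jl y)
        · rw [if_pos hxC] at h2
          exact ⟨hxC, by simp only [lab]; rw [huniq _ y h1 _ h2]⟩
        · rw [if_neg hxC] at h2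
          exact absurd h1 h2
      refine ⟨O, ?_, ?_, inter_subset_right, ?_, ?_⟩
      · refine isOpen_iInter_of_finite fun j => ?_
        split_ifs
        · exact (hWo j).preimage (hcont _)
        · exact (hCc j).isOpen_compl
      · refine mem_iInter.2 fun j => ?_
        split_ifs with h
        · exact hφ j x h
        · exact h
      · intro y hy z hz h
        have h' : jl y = jl z := h
        rw [(hOx y hy).2, (hOx z hz).2, h']
      · have hsub : lab '' (O ∩ M) ⊆ (fun j => (φ j x, j)) '' {j | x ∈ C j} := by
          rintro _ ⟨y, hy, rfl⟩
          exact ⟨jl y, (hOx y hy).1, (hOx y hy).2.symm⟩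
        refine (encard_le_encard hsub).trans ((encard_image_le _ _).trans ?_)
        exact_mod_cast hord x
  obtain ⟨h, hh1, hh2, hh3⟩ := chains hcont H hH e H0 H1 (2 ^ m) P hS
  exact part_B (2 ^ m) lab P hS.mono (fun A hA y hy => hlab y (hA.1 hy)) (fun A hA => hA.2.1)
    (fun A hA => hA.2.2) h hh1 hh2 hh3

theorem core [T2Space V] [ContractibleSpace V]
    (hcont : ∀ a : ZMod p, Continuous (fun x : V => a +ᵥ x)) (m : ℕ)
    (hloc : ∀ x : V, ∃ W, x ∈ W ∧ Loc p m W) : False := by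
  obtain ⟨e, ⟨F⟩⟩ := id_nullhomotopic V
  refine core0 hcont m hloc (fun t x => F (projIcc 0 1 zero_le_one t, x)) ?_ e ?_ ?_
  · simp only [Function.uncurry_def]
    have : Continuous (projIcc (0 : ℝ) 1 zero_le_one) := continuous_projIcc
    fun_prop
  · intro x
    simp [projIcc_left]
  · intro x
    simp [projIcc_right]

end Dim

section Cov
variable {E X : Type*} [TopologicalSpace E] [TopologicalSpace X] {q : E → X}

lemma mono_deck (hq : IsCoveringMap q) (φ : C(E, E)) (hφ : ∀ y, q (φ y) = q y) {x : X}
    (γ : FundamentalGroup X x) (e e' : q ⁻¹' {x}) (h : φ e = (e' : E)) :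
    (hq.monodromy γ e' : E) = φ (hq.monodromy γ e) := by
  obtain ⟨γ⟩ := γ
  have h1 := (hq.eq_liftPath_iff' (γ := (γ : C(unitInterval, X))) (e := (e' : E))
    (γ.source.trans e'.2.symm) (Γ := φ.comp (hq.liftPath γ e (γ.source.trans e.2.symm)))).2 ⟨by
      have := hq.liftPath_lifts γ e (γ.source.trans e.2.symm)
      funext t
      simpa [hφ] using congrFun this t, by
      simp [hq.liftPath_zero, h]⟩
  exact (DFunLike.congr_fun h1 1).symm

lemma mono_fix [SimplyConnectedSpace E] (hq : IsCoveringMap q) (e : E)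
    (γ : FundamentalGroup X (q e)) (h : (hq.monodromy γ ⟨e, rfl⟩ : E) = e) : γ = 1 := by
  obtain ⟨γ⟩ := γ
  have hs : γ 0 = q e := γ.source
  let L : Path e e := ⟨hq.liftPath γ e hs, hq.liftPath_zero _ _ _, h⟩
  have hL : L.map hq.continuous = γ := by
    ext t
    exact congrFun (hq.liftPath_lifts γ e hs) t
  have h2 : Path.Homotopic L (Path.refl e) := SimplyConnectedSpace.paths_homotopic _ _
  have h3 := h2.map (f := ⟨q, hq.continuous⟩)
  have h4 : Path.Homotopic γ (Path.refl (q e)) := by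
    rw [← hL]
    exact h3
  exact Quotient.sound h4

lemma chartX {m : ℕ} (x : X) (h : ∃ (U : Set X) (V : Set (Fin m → ℝ)),
      IsOpen U ∧ x ∈ U ∧ IsOpen V ∧ Nonempty (U ≃ₜ V)) :
    ∃ c : OpenPartialHomeomorph X (Fin m → ℝ), x ∈ c.source := by
  obtain ⟨U, V, hU, hx, hV, ⟨f⟩⟩ := h
  let U' : TopologicalSpace.Opens X := ⟨U, hU⟩
  let V' : TopologicalSpace.Opens (Fin m → ℝ) := ⟨V, hV⟩
  have nU : Nonempty U' := ⟨⟨x, hx⟩⟩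
  have nV : Nonempty V' := ⟨f ⟨x, hx⟩⟩
  let f' : U' ≃ₜ V' := f
  refine ⟨((U'.openPartialHomeomorphSubtypeCoe nU).symm.trans
    f'.toOpenPartialHomeomorph).trans (V'.openPartialHomeomorphSubtypeCoe nV), ?_⟩
  simp [U', hx]

theorem final [T2Space X] (m : ℕ)
    (hman : ∀ x : X, ∃ (U : Set X) (V : Set (Fin m → ℝ)),
      IsOpen U ∧ x ∈ U ∧ IsOpen V ∧ Nonempty (U ≃ₜ V))
    (hq : IsCoveringMap q) [ContractibleSpace E] (e₀ : E) (γ : FundamentalGroup X (q e₀))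
    (r : ℕ) [Fact r.Prime] (hγ : orderOf γ = r) : False := by
  have hT2 : T2Space E := by
    refine ⟨fun a b hab => ?_⟩
    by_cases h : q a = q b
    · exact hq.isSeparatedMap a b h hab
    · obtain ⟨u, v, hu, hv, ha, hb, huv⟩ := t2_separation h
      exact ⟨q ⁻¹' u, q ⁻¹' v, hu.preimage hq.continuous, hv.preimage hq.continuous, ha, hb,
        huv.preimage q⟩
  have hc : ∀ x : X, ∃ c : OpenPartialHomeomorph X (Fin m → ℝ), x ∈ c.source :=
    fun x => chartX x (hman x)
  choose c hc using hc
  have hψ := hq.isLocalHomeomorph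
  choose ψ hψs hψq using hψ
  have hW : ∀ y : E, y ∈ ((ψ y).trans (c (q y))).source := by
    intro y
    rw [OpenPartialHomeomorph.trans_source]
    refine ⟨hψs y, ?_⟩
    rw [mem_preimage, ← hψq y]
    exact hc _
  letI : ChartedSpace (Fin m → ℝ) E :=
    { atlas := univ
      chartAt := fun y => (ψ y).trans (c (q y))
      mem_chart_source := hW
      chart_mem_atlas := fun _ => mem_univ _ }
  haveI : LocallyPathConnectedSpace E := ChartedSpace.locallyPathConnectedSpace (Fin m → ℝ) E
  obtain ⟨φ, ⟨hφ0, hφq⟩, -⟩ := hq.existsUnique_continuousMap_lifts ⟨q, hq.continuous⟩ e₀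
    (hq.monodromy γ ⟨e₀, rfl⟩) (hq.monodromy γ ⟨e₀, rfl⟩).2
  have hφ : ∀ y, q (φ y) = q y := fun y => congrFun hφq y
  have hitc : ∀ k : ℕ, Continuous (φ^[k]) := fun k => φ.continuous.iterate k
  have hitq : ∀ (k : ℕ) (y : E), q (φ^[k] y) = q y := by
    intro k
    induction k with
    | zero => intro y; rfl
    | succ k ih => intro y; rw [Function.iterate_succ_apply, ih, hφ]
  have hit : ∀ k : ℕ, φ^[k] e₀ = (hq.monodromy (γ ^ k) ⟨e₀, rfl⟩ : E) := by
    intro k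
    induction k with
    | zero =>
      rw [pow_zero, FundamentalGroup.one_def, hq.monodromy_refl]; rfl
    | succ k ih =>
      rw [pow_succ', FundamentalGroup.mul_def, hq.monodromy_trans_apply,
        Function.iterate_succ_apply, hφ0]
      exact (mono_deck hq ⟨_, hitc k⟩ (hitq k) γ ⟨e₀, rfl⟩ _ ih).symm
  have hid : ∀ (k : ℕ) (y : E), φ^[k] y = y → ∀ z, φ^[k] z = z := by
    intro k y hy z
    have := hq.eq_of_comp_eq (hitc k) continuous_id (by funext z; exact hitq k z) y hy
    exact congrFun this z
  have hper : ∀ z, φ^[r] z = z := by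
    apply hid r e₀
    rw [hit, ← hγ, pow_orderOf_eq_one, FundamentalGroup.one_def, hq.monodromy_refl]; rfl
  have hfree : ∀ (k : ℕ) (y : E), φ^[k] y = y → r ∣ k := by
    intro k y hy
    have h1 := hid k y hy e₀
    rw [hit] at h1
    rw [← hγ]
    exact orderOf_dvd_of_pow_eq_one (mono_fix hq e₀ _ h1)
  letI : AddAction (ZMod r) E :=
    { vadd := fun a y => φ^[a.val] y
      zero_vadd := fun y => by
        change φ^[(0 : ZMod r).val] y = y
        rw [ZMod.val_zero]; rfl
      add_vadd := fun a b y => by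
        change φ^[(a + b).val] y = φ^[a.val] (φ^[b.val] y)
        rw [ZMod.val_add, ← Function.iterate_add_apply]
        exact Function.IsPeriodicPt.iterate_mod_apply (hper y) _ }
  have hv : ∀ (a : ZMod r) (y : E), a +ᵥ y = φ^[a.val] y := fun _ _ => rfl
  have hvq : ∀ (a : ZMod r) (y : E), q (a +ᵥ y) = q y := fun a y => hitq _ y
  refine core (p := r) (V := E) (fun a => hitc a.val) m (fun y => ⟨_, hW y, ?_⟩)
  have hsub : ∀ z ∈ sat r ((ψ y).trans (c (q y))).source, q z ∈ (c (q y)).source := by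
    rintro z ⟨a, ha⟩
    rw [OpenPartialHomeomorph.trans_source] at ha
    have := ha.2
    rwa [mem_preimage, ← hψq y, hvq] at this
  refine ⟨((ψ y).trans (c (q y))).open_source, ?_, fun z => c (q y) (q z), ?_, ?_, ?_⟩
  · intro a ha z hz haz
    have h1 : a +ᵥ z = z := by
      rw [OpenPartialHomeomorph.trans_source] at hz haz
      apply (ψ y).injOn haz.1 hz.1
      rw [← hψq y, hvq]
    rw [hv] at h1
    have h2 := hfree _ _ h1
    have h3 := Nat.eq_zero_of_dvd_of_lt h2 a.val_lt
    exact ha ((ZMod.val_eq_zero a).1 h3)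
  · exact (c (q y)).continuousOn.comp hq.continuous.continuousOn hsub
  · intro a z _
    simp only [hvq]
  · intro z hz w hw hzw
    apply ((ψ y).trans (c (q y))).injOn hz hw
    simpa [← hψq y] using hzw

end Cov

end
end TFree
end Bb

/-- A connected Hausdorff topological manifold (every point has an open neighbourhood
homeomorphic to an open subset of `ℝ^m` for a fixed finite `m`) admitting a covering
map from a contractible space has torsion-free fundamental group: every element of
finite order is the identity. -/
theorem fundamentalGroup_torsionFree_of_contractible_covering
    {E X : Type*} [TopologicalSpace E] [TopologicalSpace X]
    [ConnectedSpace X] [T2Space X] (m : ℕ)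
    (hman : ∀ x : X, ∃ (U : Set X) (V : Set (Fin m → ℝ)),
      IsOpen U ∧ x ∈ U ∧ IsOpen V ∧ Nonempty (U ≃ₜ V))
    (p : E → X) (hp : IsCoveringMap p) (hsurj : Function.Surjective p)
    [ContractibleSpace E] (x : X) :
    ∀ g : FundamentalGroup X x, IsOfFinOrder g → g = 1 := by
  intro g hg
  by_contra hne
  obtain ⟨e₀, rfl⟩ := hsurj x
  have h1 : orderOf g ≠ 1 := fun h => hne (orderOf_eq_one_iff.1 h)
  obtain ⟨r, hr, hdvd⟩ := Nat.exists_prime_and_dvd h1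
  have : Fact r.Prime := ⟨hr⟩
  exact TFree.final m hman hp e₀ (g ^ (orderOf g / r)) r
    (orderOf_pow_orderOf_div (orderOf_pos_iff.2 hg).ne' hdvd)
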